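/- arXiv:1905.12778 — 8 statements merged into one kernel-verified Lean document; each statement's English description precedes it below -/
import Mathlib

section
/- Let α, β > 0 and let ALG ≥ 0 be a real number. Suppose: (i) for every resource i ∈ I and every assignment ω_{-i} of outcomes to the edges not incident on i, E_ω[θ^ω_i + ∑_{t : O^ω_t = i} λ^ω_t | ω_{-i}] ≥ α·E_ω[OPT^ω_i | ω_{-i}]; and (ii) β·ALG ≥ ∑_{i∈I} E_ω[θ^ω_i] + ∑_{t∈T} E_ω[λ^ω_t]. Then ALG ≥ (α/β)·∑_{i∈I} E_ω[OPT^ω_i]. -/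
open Finset

variable {I T : Type*}

/-- Probability of a sample path `ω : E → Bool` under the product measure where
edge `e` succeeds independently with probability `p e`. -/
noncomputable def pathWeight [Fintype I] [DecidableEq I] [Fintype T] [LinearOrder T]
    (E : Finset (I × T)) (p : I × T → ℝ) (ω : ↥E → Bool) : ℝ :=
  ∏ e : ↥E, if ω e then p e.val else 1 - p e.val

/-- Expectation over sample paths `ω : E → Bool`. -/
noncomputable def pExp [Fintype I] [DecidableEq I] [Fintype T] [LinearOrder T]
    (E : Finset (I × T)) (p : I × T → ℝ) (f : (↥E → Bool) → ℝ) : ℝ :=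
  ∑ ω : ↥E → Bool, pathWeight E p ω * f ω

/-- The sample path which agrees with `ω` on all edges incident to resource `i`
and with `σ` on all remaining edges. -/
def mergeAtRes [Fintype I] [DecidableEq I] [Fintype T] [LinearOrder T]
    (E : Finset (I × T)) (i : I) (σ ω : ↥E → Bool) : ↥E → Bool :=
  fun e => if e.val.1 = i then ω e else σ e

/-- Conditional expectation `E_ω[f | ω_{-i}]`, where `ω_{-i}` is the restriction of
`σ` to edges not incident on resource `i`: we integrate over the outcomes of the
edges incident on `i`. -/
noncomputable def condExpMinus [Fintype I] [DecidableEq I] [Fintype T] [LinearOrder T]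
    (E : Finset (I × T)) (p : I × T → ℝ) (i : I) (σ : ↥E → Bool)
    (f : (↥E → Bool) → ℝ) : ℝ :=
  ∑ ω : ↥E → Bool,
    (∏ e ∈ univ.filter (fun e : ↥E => e.val.1 = i), if ω e then p e.val else 1 - p e.val) *
      f (mergeAtRes E i σ ω)

/-- Each arrival is matched at most once, so its value is counted at most once. -/
lemma sum_matched_le [Fintype I] [DecidableEq I] [Fintype T]
    (o : T → Option I) {v : T → ℝ} (hv : ∀ t, 0 ≤ v t) :
    ∑ i : I, ∑ t ∈ univ.filter (fun t : T => o t = some i), v t ≤ ∑ t : T, v t := by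
  simp only [Finset.sum_filter]
  rw [Finset.sum_comm]
  refine Finset.sum_le_sum fun t _ => ?_
  cases h : o t with
  | none => simpa using hv t
  | some j => simp

/-- The probability of the outcomes of the edges incident on resource `i`. -/
noncomputable def incidentWeight [DecidableEq I] (E : Finset (I × T))
    (p : I × T → ℝ) (i : I) (ω : ↥E → Bool) : ℝ :=
  ∏ e ∈ univ.filter (fun e : ↥E => e.val.1 = i), if ω e then p e.val else 1 - p e.val

lemma sum_incidentWeight_pos [DecidableEq I] [DecidableEq T] (E : Finset (I × T))
    (p : I × T → ℝ) (i : I) :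
    0 < ∑ ω : ↥E → Bool, incidentWeight E p i ω := by
  have h : ∑ ω : ↥E → Bool, incidentWeight E p i ω = ∏ e : ↥E, ∑ b : Bool,
      if e.val.1 = i then (if b then p e.val else 1 - p e.val) else 1 := by
    rw [Fintype.prod_sum]
    exact Finset.sum_congr rfl fun ω _ => Finset.prod_filter _ _
  rw [h]
  refine Finset.prod_pos fun e _ => ?_
  by_cases he : e.val.1 = i <;> simp [he]

section Helpers

variable [Fintype I] [DecidableEq I] [Fintype T] [LinearOrder T]

/-- Exchanging the outcomes of the edges incident on `i` between two paths. -/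
def swapAtRes (E : Finset (I × T)) (i : I) :
    Equiv.Perm ((↥E → Bool) × (↥E → Bool)) :=
  Function.Involutive.toPerm
    (fun x => (mergeAtRes E i x.1 x.2, mergeAtRes E i x.2 x.1)) (by
      rintro ⟨σ, ω⟩
      ext e <;> by_cases he : e.val.1 = i <;> simp [mergeAtRes, he])

lemma incidentWeight_mergeAtRes (E : Finset (I × T)) (p : I × T → ℝ) (i : I)
    (σ ω : ↥E → Bool) :
    incidentWeight E p i (mergeAtRes E i σ ω) = incidentWeight E p i ω := by
  refine Finset.prod_congr rfl fun e he => ?_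
  simp [mergeAtRes, (Finset.mem_filter.mp he).2]

lemma pathWeight_mul_incidentWeight_swap (E : Finset (I × T)) (p : I × T → ℝ) (i : I)
    (σ ω : ↥E → Bool) :
    pathWeight E p (mergeAtRes E i σ ω) * incidentWeight E p i (mergeAtRes E i ω σ) =
      pathWeight E p σ * incidentWeight E p i ω := by
  have split (τ : ↥E → Bool) : pathWeight E p τ = incidentWeight E p i τ *
      ∏ e ∈ univ.filter (fun e : ↥E => ¬ e.val.1 = i), if τ e then p e.val else 1 - p e.val :=
    (Finset.prod_filter_mul_prod_filter_not _ _ _).symm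
  have off : (∏ e ∈ univ.filter (fun e : ↥E => ¬ e.val.1 = i),
        if mergeAtRes E i σ ω e then p e.val else 1 - p e.val) =
      ∏ e ∈ univ.filter (fun e : ↥E => ¬ e.val.1 = i), if σ e then p e.val else 1 - p e.val := by
    refine Finset.prod_congr rfl fun e he => ?_
    simp [mergeAtRes, (Finset.mem_filter.mp he).2]
  rw [split, split σ, off, incidentWeight_mergeAtRes, incidentWeight_mergeAtRes]
  ring

/-- The tower property, up to the total mass of the weights defining `condExpMinus`. -/
lemma pExp_condExpMinus (E : Finset (I × T)) (p : I × T → ℝ) (i : I)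
    (f : (↥E → Bool) → ℝ) :
    pExp E p (fun σ => condExpMinus E p i σ f) =
      (∑ ω : ↥E → Bool, incidentWeight E p i ω) * pExp E p f := by
  calc pExp E p (fun σ => condExpMinus E p i σ f)
      = ∑ x : (↥E → Bool) × (↥E → Bool),
          pathWeight E p x.1 * incidentWeight E p i x.2 * f (mergeAtRes E i x.1 x.2) := by
        simp only [pExp, condExpMinus, incidentWeight, Fintype.sum_prod_type, Finset.mul_sum,
          mul_assoc]
    _ = ∑ x : (↥E → Bool) × (↥E → Bool),
          pathWeight E p x.1 * incidentWeight E p i x.2 * f x.1 := by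
        refine Fintype.sum_equiv (swapAtRes E i) _ _ fun x => ?_
        exact congrArg (· * f (mergeAtRes E i x.1 x.2))
          (pathWeight_mul_incidentWeight_swap E p i x.1 x.2).symm
    _ = (∑ ω : ↥E → Bool, incidentWeight E p i ω) * pExp E p f := by
        rw [Fintype.sum_prod_type_right, Finset.sum_mul]
        refine Finset.sum_congr rfl fun ω _ => ?_
        rw [pExp, Finset.mul_sum]
        exact Finset.sum_congr rfl fun σ _ => by ring

lemma pathWeight_nonneg {E : Finset (I × T)} {p : I × T → ℝ}
    (hp : ∀ e ∈ E, 0 ≤ p e ∧ p e ≤ 1) (ω : ↥E → Bool) : 0 ≤ pathWeight E p ω := by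
  refine Finset.prod_nonneg fun e _ => ?_
  have := hp e.val e.property
  split_ifs <;> linarith

lemma pExp_mono {E : Finset (I × T)} {p : I × T → ℝ}
    (hp : ∀ e ∈ E, 0 ≤ p e ∧ p e ≤ 1) {f g : (↥E → Bool) → ℝ} (h : ∀ ω, f ω ≤ g ω) :
    pExp E p f ≤ pExp E p g :=
  Finset.sum_le_sum fun ω _ => mul_le_mul_of_nonneg_left (h ω) (pathWeight_nonneg hp ω)

lemma pExp_const_mul (E : Finset (I × T)) (p : I × T → ℝ) (c : ℝ) (f : (↥E → Bool) → ℝ) :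
    pExp E p (fun ω => c * f ω) = c * pExp E p f := by
  simp only [pExp, Finset.mul_sum, mul_left_comm]

lemma pExp_add (E : Finset (I × T)) (p : I × T → ℝ) (f g : (↥E → Bool) → ℝ) :
    pExp E p (fun ω => f ω + g ω) = pExp E p f + pExp E p g := by
  simp only [pExp, mul_add, Finset.sum_add_distrib]

lemma pExp_sum {κ : Type*} (s : Finset κ) (E : Finset (I × T)) (p : I × T → ℝ)
    (f : κ → (↥E → Bool) → ℝ) :
    pExp E p (fun ω => ∑ k ∈ s, f k ω) = ∑ k ∈ s, pExp E p (f k) := by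
  simp only [pExp, Finset.mul_sum]
  exact Finset.sum_comm

/-- A conditional inequality given the outcomes off resource `i` holds in expectation. -/
lemma pExp_le_of_condExpMinus_le {E : Finset (I × T)} {p : I × T → ℝ}
    (hp : ∀ e ∈ E, 0 ≤ p e ∧ p e ≤ 1) {i : I} {c : ℝ} {f g : (↥E → Bool) → ℝ}
    (h : ∀ σ, c * condExpMinus E p i σ f ≤ condExpMinus E p i σ g) :
    c * pExp E p f ≤ pExp E p g := by
  have key := pExp_mono hp h
  rw [pExp_const_mul, pExp_condExpMinus, pExp_condExpMinus, mul_left_comm] at key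
  exact le_of_mul_le_mul_left key (sum_incidentWeight_pos E p i)

end Helpers

/-- the LP-free certification lemma: if nonnegative families `λ, θ`
satisfy, for every resource `i` and every partial path `ω_{-i}`,
`E_ω[θ^ω_i + ∑_{t : O^ω_t = i} λ^ω_t | ω_{-i}] ≥ α E_ω[OPT^ω_i | ω_{-i}]`,
and `β·ALG ≥ ∑_i E_ω[θ^ω_i] + ∑_t E_ω[λ^ω_t]`, then
`ALG ≥ (α/β) ∑_i E_ω[OPT^ω_i]`. -/
theorem stmt1 [Fintype I] [DecidableEq I] [Fintype T] [LinearOrder T]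
    (E : Finset (I × T)) (p : I × T → ℝ)
    (hp : ∀ e ∈ E, 0 ≤ p e ∧ p e ≤ 1)
    (α β ALG : ℝ) (hα : 0 < α) (hβ : 0 < β) (hALG : 0 ≤ ALG)
    -- the resource (if any) that the offline benchmark matches to each arrival
    (O : (↥E → Bool) → T → Option I)
    -- the reward the benchmark earns from each resource on each path
    (OPTi : I → (↥E → Bool) → ℝ) (hOPTi : ∀ i ω, 0 ≤ OPTi i ω)
    (lam : T → (↥E → Bool) → ℝ) (θ : I → (↥E → Bool) → ℝ)
    (hlam : ∀ t ω, 0 ≤ lam t ω) (hθ : ∀ i ω, 0 ≤ θ i ω)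
    -- (i) the conditional inequality for every resource `i` and partial path `ω_{-i}`
    (hdual1 : ∀ (i : I) (σ : ↥E → Bool),
      α * condExpMinus E p i σ (fun ω => OPTi i ω) ≤
        condExpMinus E p i σ
          (fun ω => θ i ω + ∑ t ∈ univ.filter (fun t : T => O ω t = some i), lam t ω))
    -- (ii) the expected dual objective is at most `β · ALG`
    (hdual2 : (∑ i : I, pExp E p (fun ω => θ i ω)) + (∑ t : T, pExp E p (fun ω => lam t ω)) ≤
        β * ALG) :
    (α / β) * ∑ i : I, pExp E p (fun ω => OPTi i ω) ≤ ALG := by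
  have h_res : ∀ i, α * pExp E p (OPTi i) ≤ pExp E p (θ i) +
      pExp E p (fun ω => ∑ t ∈ univ.filter (fun t : T => O ω t = some i), lam t ω) := fun i => by
    rw [← pExp_add]
    exact pExp_le_of_condExpMinus_le hp (hdual1 i)
  have h_match : ∑ i : I, pExp E p
      (fun ω => ∑ t ∈ univ.filter (fun t : T => O ω t = some i), lam t ω) ≤
      ∑ t : T, pExp E p (lam t) := by
    rw [← pExp_sum, ← pExp_sum]
    exact pExp_mono hp fun ω => sum_matched_le (O ω) fun t => hlam t ω
  have h_total := Finset.sum_le_sum fun i (_ : i ∈ univ) => h_res i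
  rw [← Finset.mul_sum, Finset.sum_add_distrib] at h_total
  rw [div_mul_eq_mul_div, div_le_iff₀ hβ, mul_comm ALG]
  exact h_total.trans ((add_le_add_right h_match _).trans hdual2)
end

section
/- Let g : [0,∞) → [0,1] be continuously differentiable and strictly decreasing, and suppose that f(x) := 1 − e^{−x}·(1 − g(x)·(x+1)) − ∫₀^x g(z)·e^{−z} dz satisfies f(x) ≥ g(0) for every x ≥ 0. Define, for τ, τ' ≥ 0, H(τ, τ') := 1 − e^{−τ'} − ∫₀^{τ'} g(z)·e^{−z} dz + g(τ')·(τ·e^{−τ'} if τ ≤ τ', and τ'·e^{−τ'} + e^{−τ'} − e^{−τ} if τ > τ'). Then H(τ, τ') ≥ g(0)·(1 − e^{−τ}) for all τ, τ' ≥ 0. -/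
/-- the central analytic claim in the proof of the competitive-ratio
lemma for the Generalized Fully-Adaptive algorithm.  `g : [0,∞) → [0,1]` is
continuously differentiable and strictly decreasing, `f x ≥ g 0` on `[0,∞)`,
and then `H τ τ' ≥ g 0 · (1 - e^{-τ})` for all `τ, τ' ≥ 0`. -/
theorem stmt4 (g : ℝ → ℝ)
    (hg01 : ∀ x : ℝ, 0 ≤ x → g x ∈ Set.Icc (0 : ℝ) 1)
    (hgC1 : ContDiffOn ℝ 1 g (Set.Ici 0))
    (hganti : StrictAntiOn g (Set.Ici 0))
    (hf : ∀ x : ℝ, 0 ≤ x →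
      g 0 ≤ 1 - Real.exp (-x) * (1 - g x * (x + 1)) - ∫ z in (0 : ℝ)..x, g z * Real.exp (-z)) :
    ∀ τ τ' : ℝ, 0 ≤ τ → 0 ≤ τ' →
      g 0 * (1 - Real.exp (-τ)) ≤
        1 - Real.exp (-τ') - (∫ z in (0 : ℝ)..τ', g z * Real.exp (-z)) +
          g τ' * (if τ ≤ τ' then τ * Real.exp (-τ')
                  else τ' * Real.exp (-τ') + Real.exp (-τ') - Real.exp (-τ)) := by
  intro τ τ' hτ hτ'
  have hle : g τ' ≤ g 0 := hganti.antitoneOn (Set.mem_Ici.2 le_rfl) (Set.mem_Ici.2 hτ') hτ'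
  have hg : 0 ≤ g τ' := (hg01 τ' hτ').1
  have hfτ' := hf τ' hτ'
  split_ifs with h
  · -- The gap is nonincreasing in `τ` on `[0, τ']`, so the diagonal `τ = τ'` is the worst case.
    have hexp : Real.exp (-τ) = Real.exp (-τ') * Real.exp (τ' - τ) := by
      rw [← Real.exp_add]
      ring_nf
    have htangent : (τ' - τ) * Real.exp (-τ') ≤ Real.exp (-τ) - Real.exp (-τ') := by
      rw [hexp]
      nlinarith [Real.add_one_le_exp (τ' - τ), Real.exp_pos (-τ')]
    have hslope : g τ' * ((τ' - τ) * Real.exp (-τ')) ≤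
        g 0 * (Real.exp (-τ) - Real.exp (-τ')) :=
      mul_le_mul hle htangent (mul_nonneg (sub_nonneg.2 h) (Real.exp_pos _).le) (hg.trans hle)
    have hdiag := mul_le_mul_of_nonneg_right hle (Real.exp_pos (-τ')).le
    linarith
  · have hτg := mul_le_mul_of_nonneg_right hle (Real.exp_pos (-τ)).le
    linarith
end

section
/- There exist constants c₁, c₂ ≥ 0 such that for every p ∈ (0,1) and every finite sequence p₁, …, p_f of reals with 0 ≤ p_k ≤ p for all k and τ := ∑_{k=1}^f p_k > 0, one has (1 − c₁·√p)·(1 − e^{−τ}) ≤ 1 − ∏_{k=1}^f (1 − p_k) ≤ (1 + c₂·√p)·(1 − e^{−τ}). -/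
/-- A product of factors `1 - q k` is at most the exponential of minus the sum. -/
theorem prod_one_sub_le_exp_neg_sum {ι : Type*} (s : Finset ι) (q : ι → ℝ)
    (hq : ∀ k ∈ s, q k ≤ 1) :
    ∏ k ∈ s, (1 - q k) ≤ Real.exp (-∑ k ∈ s, q k) := by
  rw [← Finset.sum_neg_distrib, Real.exp_sum]
  exact Finset.prod_le_prod (fun k hk ↦ sub_nonneg.2 (hq k hk))
    fun k _ ↦ Real.one_sub_le_exp_neg (q k)

/-- If all `q k` lie in `[0, p]` with `p ≤ 1`, the product of the `1 - q k` falls short of the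
exponential of minus the sum by at most a `p`-fraction of the complementary probability. -/
theorem exp_neg_sum_sub_prod_one_sub_le {ι : Type*} (s : Finset ι) (q : ι → ℝ) {p : ℝ}
    (hp : p ≤ 1) (hq : ∀ k ∈ s, 0 ≤ q k ∧ q k ≤ p) :
    Real.exp (-∑ k ∈ s, q k) - ∏ k ∈ s, (1 - q k) ≤
      p * (1 - Real.exp (-∑ k ∈ s, q k)) := by
  classical
  induction s using Finset.induction_on with
  | empty => simp
  | insert a s ha ih =>
    have ih := ih fun k hk ↦ hq k (Finset.mem_insert_of_mem hk)
    obtain ⟨h0, hap⟩ := hq a (Finset.mem_insert_self a s)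
    have hsum : 0 ≤ ∑ k ∈ s, q k :=
      Finset.sum_nonneg fun k hk ↦ (hq k (Finset.mem_insert_of_mem hk)).1
    rw [Finset.sum_insert ha, Finset.prod_insert ha, neg_add, Real.exp_add]
    have hE0 := Real.exp_pos (-∑ k ∈ s, q k)
    have hE1 : Real.exp (-∑ k ∈ s, q k) ≤ 1 := Real.exp_le_one_iff.2 (by linarith)
    have hx1 : Real.exp (-q a) ≤ 1 := Real.exp_le_one_iff.2 (by linarith)
    have hmul : Real.exp (-q a) * (1 + q a) ≤ 1 := by
      calc Real.exp (-q a) * (1 + q a) ≤ Real.exp (-q a) * Real.exp (q a) := by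
            gcongr
            linarith [Real.add_one_le_exp (q a)]
        _ = 1 := by rw [← Real.exp_add]; simp
    have hfactor : Real.exp (-q a) - (1 - q a) ≤ p * (1 - Real.exp (-q a)) := by
      nlinarith [mul_le_mul_of_nonneg_right hap (sub_nonneg.2 hx1)]
    generalize Real.exp (-∑ k ∈ s, q k) = E at *
    generalize Real.exp (-q a) = x at *
    generalize ∏ k ∈ s, (1 - q k) = P at *
    have h1 := mul_le_mul_of_nonneg_left ih (show 0 ≤ 1 - q a by linarith)
    have h2 := mul_le_mul_of_nonneg_left hfactor hE0.le
    have h3 : 0 ≤ q a * (p * (1 - E)) :=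
      mul_nonneg h0 (mul_nonneg (h0.trans hap) (sub_nonneg.2 hE1))
    linarith

/-- the exponential-threshold approximation lemma.  There are universal
constants `c₁, c₂ ≥ 0` such that for every `p ∈ (0,1)` and every finite sequence
`p₁, …, p_f` with `0 ≤ p_k ≤ p` and `τ := ∑ p_k > 0`,
`(1 - c₁√p)(1 - e^{-τ}) ≤ 1 - ∏ (1 - p_k) ≤ (1 + c₂√p)(1 - e^{-τ})`. -/
theorem stmt5 : ∃ c₁ c₂ : ℝ, 0 ≤ c₁ ∧ 0 ≤ c₂ ∧
    ∀ p : ℝ, 0 < p → p < 1 →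
      ∀ (f : ℕ) (q : Fin f → ℝ),
        (∀ k, 0 ≤ q k ∧ q k ≤ p) →
        0 < ∑ k, q k →
        (1 - c₁ * Real.sqrt p) * (1 - Real.exp (-(∑ k, q k))) ≤ 1 - ∏ k, (1 - q k) ∧
        1 - ∏ k, (1 - q k) ≤ (1 + c₂ * Real.sqrt p) * (1 - Real.exp (-(∑ k, q k))) := by
  refine ⟨0, 1, le_rfl, zero_le_one, fun p hp0 hp1 f q hq hτ ↦ ⟨?_, ?_⟩⟩
  · have := prod_one_sub_le_exp_neg_sum Finset.univ q fun k _ ↦ (hq k).2.trans hp1.le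
    linarith
  · have h := exp_neg_sum_sub_prod_one_sub_le Finset.univ q hp1.le fun k _ ↦ hq k
    have hE : Real.exp (-∑ k, q k) ≤ 1 := Real.exp_le_one_iff.2 (by linarith)
    have hsqrt : p ≤ Real.sqrt p := Real.le_sqrt_of_sq_le (by nlinarith)
    have := mul_le_mul_of_nonneg_right hsqrt (sub_nonneg.2 hE)
    linarith
end

section
/- For every p ∈ (0,1) and every finite sequence p₁, …, p_m of reals with 0 ≤ p_k ≤ p for all k and ∑_{k=1}^m p_k ≤ 1/√p, one has ∏_{k=1}^m (1 − p_k) ≤ exp(−∑_{k=1}^m p_k) ≤ (∏_{k=1}^m (1 − p_k))·exp(√p/(1 − p)). -/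
/-- For `0 ≤ x ≤ p < 1`, the exponential `e^{-x}` exceeds `1 - x` by at most the factor
`e^{p x / (1 - p)}`. -/
lemma exp_neg_le_one_sub_mul_exp {p x : ℝ} (hp1 : p < 1) (hx0 : 0 ≤ x) (hxp : x ≤ p) :
    Real.exp (-x) ≤ (1 - x) * Real.exp (p / (1 - p) * x) := by
  have hp : 0 < 1 - p := sub_pos.2 hp1
  have hx : 0 < 1 - x := by linarith
  have hle : x / (1 - x) ≤ x / (1 - p) := by gcongr
  have hexp : x / (1 - p) + 1 ≤ Real.exp (x / (1 - p)) := Real.add_one_le_exp _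
  have hone : 1 ≤ (1 - x) * Real.exp (x / (1 - p)) := by
    calc 1 = (1 - x) * (x / (1 - x) + 1) := by field_simp; ring
      _ ≤ (1 - x) * Real.exp (x / (1 - p)) := by gcongr; linarith
  have hsplit : p / (1 - p) * x = x / (1 - p) + -x := by field_simp; ring
  rw [hsplit, Real.exp_add, ← mul_assoc]
  exact le_mul_of_one_le_left (Real.exp_pos _).le hone

/-- the core estimate in Case I of the exponential-threshold
approximation lemma: if `0 ≤ p_k ≤ p < 1` and `∑ p_k ≤ 1/√p`, then
`∏ (1 - p_k) ≤ e^{-∑ p_k} ≤ (∏ (1 - p_k)) · e^{√p/(1-p)}`. -/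
theorem stmt6 (p : ℝ) (hp0 : 0 < p) (hp1 : p < 1)
    (m : ℕ) (q : Fin m → ℝ) (hq : ∀ k, 0 ≤ q k ∧ q k ≤ p)
    (hsum : ∑ k, q k ≤ 1 / Real.sqrt p) :
    (∏ k, (1 - q k)) ≤ Real.exp (-(∑ k, q k)) ∧
    Real.exp (-(∑ k, q k)) ≤ (∏ k, (1 - q k)) * Real.exp (Real.sqrt p / (1 - p)) := by
  have hnonneg : ∀ k, 0 ≤ 1 - q k := fun k => by linarith [(hq k).2]
  rw [← Finset.sum_neg_distrib, Real.exp_sum]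
  refine ⟨Finset.prod_le_prod (fun k _ => hnonneg k)
    fun k _ => Real.one_sub_le_exp_neg (q k), ?_⟩
  have hp : 0 < 1 - p := sub_pos.2 hp1
  have hbound : p / (1 - p) * ∑ k, q k ≤ Real.sqrt p / (1 - p) := by
    calc p / (1 - p) * ∑ k, q k ≤ p / (1 - p) * (1 / Real.sqrt p) := by gcongr
      _ = p / Real.sqrt p / (1 - p) := by ring
      _ = Real.sqrt p / (1 - p) := by rw [Real.div_sqrt]
  calc ∏ k, Real.exp (-q k) ≤ ∏ k, (1 - q k) * Real.exp (p / (1 - p) * q k) :=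
        Finset.prod_le_prod (fun k _ => (Real.exp_pos _).le)
          fun k _ => exp_neg_le_one_sub_mul_exp hp1 (hq k).1 (hq k).2
    _ = (∏ k, (1 - q k)) * Real.exp (p / (1 - p) * ∑ k, q k) := by
        rw [Finset.prod_mul_distrib, Finset.mul_sum, Real.exp_sum]
    _ ≤ (∏ k, (1 - q k)) * Real.exp (Real.sqrt p / (1 - p)) := by
        gcongr
        exact Finset.prod_nonneg fun k _ => hnonneg k
end

section
/- Let g(t) := e^{t+1}·∫_{t+1}^∞ (e^{−y}/y) dy for t ≥ 0, and define f(x) := 1 − e^{−x}·(1 − g(x)·(x+1)) − ∫₀^x g(z)·e^{−z} dz for x ≥ 0. Then f is constant on [0,∞): f(x) = g(0) for every x ≥ 0. In particular min_{x ≥ 0} f(x) = g(0), and moreover g(x) − g'(x) = 1/(x+1) ≤ 1 for all x ≥ 0. -/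
open MeasureTheory

/-- The scaling function `g t = e^{t+1} · ∫_{t+1}^∞ e^{-y}/y dy`. -/
noncomputable def gStar (t : ℝ) : ℝ := Real.exp (t + 1) * ∫ y in Set.Ioi (t + 1), Real.exp (-y) / y

/-- The function `f x = 1 - e^{-x}(1 - g(x)(x+1)) - ∫₀ˣ g(z) e^{-z} dz` for `g = gStar`. -/
noncomputable def fStar (x : ℝ) : ℝ :=
  1 - Real.exp (-x) * (1 - gStar x * (x + 1)) - ∫ z in (0 : ℝ)..x, gStar z * Real.exp (-z)

lemma integrableOn_exp_neg_div_Ioi {a : ℝ} (ha : 0 < a) :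
    IntegrableOn (fun y : ℝ => Real.exp (-y) / y) (Set.Ioi a) := by
  refine Integrable.mono' ((integrableOn_exp_neg_Ioi a).div_const a)
    (Measurable.aestronglyMeasurable (by fun_prop)) ?_
  filter_upwards [ae_restrict_mem measurableSet_Ioi] with y hy
  have hay : a < y := hy
  have hy0 : 0 < y := ha.trans hay
  rw [Real.norm_of_nonneg (by positivity)]
  gcongr

lemma hasDerivAt_integral_exp_neg_div_Ioi {x : ℝ} (hx : 0 < x) :
    HasDerivAt (fun t : ℝ => ∫ y in Set.Ioi t, Real.exp (-y) / y) (-(Real.exp (-x) / x)) x := by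
  have hcont : ContinuousAt (fun y : ℝ => Real.exp (-y) / y) x := by
    fun_prop (disch := exact hx.ne')
  have hmeas : Measurable (fun y : ℝ => Real.exp (-y) / y) := by fun_prop
  have hder : HasDerivAt (fun t : ℝ => ∫ y in x..t, Real.exp (-y) / y) (Real.exp (-x) / x) x :=
    intervalIntegral.integral_hasDerivAt_right (by simp)
      hmeas.stronglyMeasurable.stronglyMeasurableAtFilter hcont
  refine (hder.const_sub (∫ y in Set.Ioi x, Real.exp (-y) / y)).congr_of_eventuallyEq ?_
  filter_upwards [lt_mem_nhds hx] with t ht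
  rw [← intervalIntegral.integral_Ioi_sub_Ioi' (integrableOn_exp_neg_div_Ioi hx)
    (integrableOn_exp_neg_div_Ioi ht), sub_sub_cancel]

lemma hasDerivAt_gStar {x : ℝ} (hx : -1 < x) :
    HasDerivAt gStar (gStar x - 1 / (x + 1)) x := by
  have hx1 : 0 < x + 1 := by linarith
  have hshift : HasDerivAt (fun t : ℝ => t + 1) 1 x := (hasDerivAt_id x).add_const 1
  refine (hshift.exp.mul
    ((hasDerivAt_integral_exp_neg_div_Ioi hx1).comp x hshift)).congr_deriv ?_
  have hexp : Real.exp (x + 1) * Real.exp (-(x + 1)) = 1 := by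
    rw [← Real.exp_add, add_neg_cancel, Real.exp_zero]
  simp only [gStar, Function.comp_apply]
  linear_combination (-1 / (x + 1)) * hexp

lemma hasDerivAt_neg_exp_neg_mul_one_sub_gStar {x : ℝ} (hx : -1 < x) :
    HasDerivAt (fun z => -(Real.exp (-z) * (1 - gStar z * (z + 1))))
      (gStar x * Real.exp (-x)) x := by
  have hx1 : x + 1 ≠ 0 := by linarith
  have hshift : HasDerivAt (fun t : ℝ => t + 1) 1 x := (hasDerivAt_id x).add_const 1
  refine ((hasDerivAt_neg x).exp.mul
    (((hasDerivAt_gStar hx).mul hshift).const_sub 1)).neg.congr_deriv ?_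
  simp only [Pi.mul_apply]
  field_simp
  ring

lemma fStar_eq_gStar_zero {x : ℝ} (hx : 0 ≤ x) : fStar x = gStar 0 := by
  have hgt : ∀ z ∈ Set.uIcc 0 x, -1 < z := fun z hz => by
    rw [Set.uIcc_of_le hx] at hz
    linarith [hz.1]
  have hint : IntervalIntegrable (fun z => gStar z * Real.exp (-z)) volume 0 x :=
    ContinuousOn.intervalIntegrable fun z hz =>
      ((hasDerivAt_gStar (hgt z hz)).continuousAt.mul (by fun_prop)).continuousWithinAt
  rw [fStar, intervalIntegral.integral_eq_sub_of_hasDerivAt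
    (fun z hz => hasDerivAt_neg_exp_neg_mul_one_sub_gStar (hgt z hz)) hint]
  simp only [neg_zero, Real.exp_zero, zero_add]
  ring

/-- `fStar` is constant equal to `gStar 0` on `[0,∞)` (so its minimum is
`gStar 0`), and `g(x) - g'(x) = 1/(x+1) ≤ 1` for all `x ≥ 0`. -/
theorem stmt9 :
    (∀ x : ℝ, 0 ≤ x → fStar x = gStar 0) ∧
    ∀ x : ℝ, 0 ≤ x →
      HasDerivAt gStar (gStar x - 1 / (x + 1)) x ∧ 1 / (x + 1) ≤ 1 := by
  refine ⟨fun x hx => fStar_eq_gStar_zero hx, fun x hx => ⟨hasDerivAt_gStar (by linarith), ?_⟩⟩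
  rw [div_le_one (by linarith)]
  linarith
end

section
/- The value g(0) = e·∫₁^∞ (e^{−y}/y) dy satisfies 0.5963 ≤ e·∫₁^∞ (e^{−y}/y) dy ≤ 0.5964; in particular e·∫₁^∞ (e^{−y}/y) dy > 0.596. -/
open MeasureTheory

section Rational

open Polynomial Set Filter Topology

/-- The numerator over `q ^ 2` of `R` minus its derivative, where `R = p / q`. -/
noncomputable def expDerivNum (p q : ℝ[X]) : ℝ[X] :=
  q * (p - derivative p) + p * derivative q

theorem hasDerivAt_neg_exp_neg_mul_div (p q : ℝ[X]) {y : ℝ} (hq : q.eval y ≠ 0) :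
    HasDerivAt (fun y : ℝ => -(Real.exp (-y) * (p.eval y / q.eval y)))
      (Real.exp (-y) * ((expDerivNum p q).eval y / q.eval y ^ 2)) y := by
  have h := (((hasDerivAt_neg y).exp).mul ((p.hasDerivAt y).div (q.hasDerivAt y) hq)).neg
  refine h.congr_deriv ?_
  simp only [expDerivNum, eval_add, eval_mul, eval_sub, Pi.div_apply]
  field_simp
  ring

theorem tendsto_neg_exp_neg_mul_div (p q : ℝ[X]) {M : ℝ} (hq : ∀ y, 1 ≤ y → 0 < q.eval y)
    (hp : ∀ y, 1 ≤ y → 0 ≤ p.eval y) (hM : ∀ y, 1 ≤ y → p.eval y ≤ M * q.eval y) :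
    Tendsto (fun y : ℝ => -(Real.exp (-y) * (p.eval y / q.eval y))) atTop (𝓝 0) := by
  have hexp : Tendsto (fun y : ℝ => Real.exp (-y) * M) atTop (𝓝 0) := by
    simpa using (Real.tendsto_exp_neg_atTop_nhds_zero).mul_const M
  have h : Tendsto (fun y : ℝ => Real.exp (-y) * (p.eval y / q.eval y)) atTop (𝓝 0) := by
    refine squeeze_zero' ?_ ?_ hexp
    · filter_upwards [eventually_ge_atTop 1] with y hy
      exact mul_nonneg (Real.exp_pos _).le (div_nonneg (hp y hy) (hq y hy).le)
    · filter_upwards [eventually_ge_atTop 1] with y hy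
      exact mul_le_mul_of_nonneg_left ((div_le_iff₀ (hq y hy)).2 (hM y hy)) (Real.exp_pos _).le
  simpa using h.neg

theorem integrableOn_exp_neg_mul_expDerivNum (p q : ℝ[X]) {M : ℝ}
    (hq : ∀ y, 1 ≤ y → 0 < q.eval y) (hp : ∀ y, 1 ≤ y → 0 ≤ p.eval y)
    (hM : ∀ y, 1 ≤ y → p.eval y ≤ M * q.eval y)
    (hW : ∀ y, 1 ≤ y → 0 ≤ (expDerivNum p q).eval y) :
    IntegrableOn (fun y : ℝ => Real.exp (-y) * ((expDerivNum p q).eval y / q.eval y ^ 2))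
      (Ioi 1) :=
  integrableOn_Ioi_deriv_of_nonneg'
    (fun y hy => hasDerivAt_neg_exp_neg_mul_div p q (hq y hy).ne')
    (fun y hy => mul_nonneg (Real.exp_pos _).le (div_nonneg (hW y (le_of_lt hy)) (sq_nonneg _)))
    (tendsto_neg_exp_neg_mul_div p q hq hp hM)

theorem exp_one_mul_integral_exp_neg_mul_expDerivNum (p q : ℝ[X]) {M : ℝ}
    (hq : ∀ y, 1 ≤ y → 0 < q.eval y) (hp : ∀ y, 1 ≤ y → 0 ≤ p.eval y)
    (hM : ∀ y, 1 ≤ y → p.eval y ≤ M * q.eval y)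
    (hW : ∀ y, 1 ≤ y → 0 ≤ (expDerivNum p q).eval y) :
    Real.exp 1 * ∫ y in Ioi (1 : ℝ), Real.exp (-y) * ((expDerivNum p q).eval y / q.eval y ^ 2) =
      p.eval 1 / q.eval 1 := by
  rw [integral_Ioi_of_hasDerivAt_of_tendsto'
    (fun y hy => hasDerivAt_neg_exp_neg_mul_div p q (hq y hy).ne')
    (integrableOn_exp_neg_mul_expDerivNum p q hq hp hM hW)
    (tendsto_neg_exp_neg_mul_div p q hq hp hM), zero_sub, neg_neg, ← mul_assoc, ← Real.exp_add]
  simp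

theorem integrableOn_exp_neg_div :
    IntegrableOn (fun y : ℝ => Real.exp (-y) / y) (Ioi 1) := by
  refine Integrable.mono' (integrableOn_exp_neg_Ioi 1) ?_ ?_
  · exact Measurable.aestronglyMeasurable (by fun_prop)
  · filter_upwards [ae_restrict_mem measurableSet_Ioi] with y hy
    have hy : (1 : ℝ) < y := hy
    rw [Real.norm_of_nonneg (by positivity)]
    exact div_le_self (Real.exp_pos _).le hy.le

theorem le_exp_one_mul_integral_exp_neg_div (p q : ℝ[X]) {M : ℝ}
    (hq : ∀ y, 1 ≤ y → 0 < q.eval y) (hp : ∀ y, 1 ≤ y → 0 ≤ p.eval y)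
    (hM : ∀ y, 1 ≤ y → p.eval y ≤ M * q.eval y)
    (hW : ∀ y, 1 ≤ y → 0 ≤ (expDerivNum p q).eval y)
    (hle : ∀ y, 1 ≤ y → y * (expDerivNum p q).eval y ≤ q.eval y ^ 2) :
    p.eval 1 / q.eval 1 ≤ Real.exp 1 * ∫ y in Ioi (1 : ℝ), Real.exp (-y) / y := by
  rw [← exp_one_mul_integral_exp_neg_mul_expDerivNum p q hq hp hM hW]
  refine mul_le_mul_of_nonneg_left ?_ (Real.exp_pos _).le
  refine setIntegral_mono_on (integrableOn_exp_neg_mul_expDerivNum p q hq hp hM hW)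
    integrableOn_exp_neg_div measurableSet_Ioi fun y hy => ?_
  have hy : (1 : ℝ) < y := hy
  rw [div_eq_mul_one_div (Real.exp (-y))]
  refine mul_le_mul_of_nonneg_left ?_ (Real.exp_pos _).le
  rw [div_le_div_iff₀ (pow_pos (hq y hy.le) 2) (by linarith)]
  linarith [hle y hy.le]

theorem exp_one_mul_integral_exp_neg_div_le (p q : ℝ[X]) {M : ℝ}
    (hq : ∀ y, 1 ≤ y → 0 < q.eval y) (hp : ∀ y, 1 ≤ y → 0 ≤ p.eval y)
    (hM : ∀ y, 1 ≤ y → p.eval y ≤ M * q.eval y)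
    (hle : ∀ y, 1 ≤ y → q.eval y ^ 2 ≤ y * (expDerivNum p q).eval y) :
    Real.exp 1 * ∫ y in Ioi (1 : ℝ), Real.exp (-y) / y ≤ p.eval 1 / q.eval 1 := by
  have hW : ∀ y, 1 ≤ y → 0 ≤ (expDerivNum p q).eval y := fun y hy =>
    nonneg_of_mul_nonneg_right ((sq_nonneg _).trans (hle y hy)) (by linarith)
  rw [← exp_one_mul_integral_exp_neg_mul_expDerivNum p q hq hp hM hW]
  refine mul_le_mul_of_nonneg_left ?_ (Real.exp_pos _).le
  refine setIntegral_mono_on integrableOn_exp_neg_div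
    (integrableOn_exp_neg_mul_expDerivNum p q hq hp hM hW) measurableSet_Ioi fun y hy => ?_
  have hy : (1 : ℝ) < y := hy
  rw [div_eq_mul_one_div (Real.exp (-y))]
  refine mul_le_mul_of_nonneg_left ?_ (Real.exp_pos _).le
  rw [div_le_div_iff₀ (by linarith) (pow_pos (hq y hy.le) 2)]
  linarith [hle y hy.le]

/-- Numerator of the 20th convergent of the Stieltjes continued fraction of `exp y * E₁ y`. -/
noncomputable def lowerNum : ℝ[X] :=
  X ^ 9 + 99 * X ^ 8 + 3952 * X ^ 7 + 82544 * X ^ 6 + 979524 * X ^ 5 + 6712860 * X ^ 4 +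
    25815840 * X ^ 3 + 51369120 * X ^ 2 + 44339040 * X + 10628640

/-- Denominator of the 20th convergent of the Stieltjes continued fraction of `exp y * E₁ y`. -/
noncomputable def lowerDen : ℝ[X] :=
  X ^ 10 + 100 * X ^ 9 + 4050 * X ^ 8 + 86400 * X ^ 7 + 1058400 * X ^ 6 + 7620480 * X ^ 5 +
    31752000 * X ^ 4 + 72576000 * X ^ 3 + 81648000 * X ^ 2 + 36288000 * X + 3628800

/-- Numerator of the 21st convergent of the Stieltjes continued fraction of `exp y * E₁ y`. -/
noncomputable def upperNum : ℝ[X] :=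
  X ^ 10 + 109 * X ^ 9 + 4842 * X ^ 8 + 114064 * X ^ 7 + 1553664 * X ^ 6 + 12518100 * X ^ 5 +
    58603440 * X ^ 4 + 150023520 * X ^ 3 + 184386240 * X ^ 2 + 80627040 * X + 3628800

/-- Denominator of the 21st convergent of the Stieltjes continued fraction of `exp y * E₁ y`. -/
noncomputable def upperDen : ℝ[X] :=
  X ^ 11 + 110 * X ^ 10 + 4950 * X ^ 9 + 118800 * X ^ 8 + 1663200 * X ^ 7 + 13970880 * X ^ 6 +
    69854400 * X ^ 5 + 199584000 * X ^ 4 + 299376000 * X ^ 3 + 199584000 * X ^ 2 + 39916800 * X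

theorem eval_lowerDen_ge {y : ℝ} (hy : 1 ≤ y) : 3628800 ≤ lowerDen.eval y := by
  have hy0 : 0 ≤ y := by linarith
  simp only [lowerDen, eval_add, eval_mul, eval_pow, eval_X, eval_ofNat]
  exact le_add_of_nonneg_left (by positivity)

theorem mul_eval_expDerivNum_lower (y : ℝ) :
    y * (expDerivNum lowerNum lowerDen).eval y = lowerDen.eval y ^ 2 - 3628800 ^ 2 := by
  simp [expDerivNum, lowerNum, lowerDen]
  ring

theorem mul_eval_expDerivNum_upper (y : ℝ) :
    y * (expDerivNum upperNum upperDen).eval y = upperDen.eval y ^ 2 + 11 * 3628800 ^ 2 * y := by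
  simp [expDerivNum, upperNum, upperDen]
  ring

theorem lower_bound :
    0.5963 ≤ Real.exp 1 * ∫ y in Ioi (1 : ℝ), Real.exp (-y) / y := by
  have hsq {y : ℝ} (hy : 1 ≤ y) : (3628800 : ℝ) ^ 2 ≤ lowerDen.eval y ^ 2 :=
    pow_le_pow_left₀ (by norm_num) (eval_lowerDen_ge hy) 2
  refine le_trans ?_ (le_exp_one_mul_integral_exp_neg_div lowerNum lowerDen (M := 3)
    (fun y hy => by linarith [eval_lowerDen_ge hy]) (fun y hy => ?_) (fun y hy => ?_)
    (fun y hy => ?_) (fun y hy => ?_))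
  · norm_num [lowerNum, lowerDen]
  · have hy0 : 0 ≤ y := by linarith
    simp only [lowerNum, eval_add, eval_mul, eval_pow, eval_X, eval_ofNat]
    positivity
  · have hy0 : 0 ≤ y := by linarith
    rw [← sub_nonneg]
    simp only [lowerNum, lowerDen, eval_add, eval_mul, eval_pow, eval_X, eval_ofNat]
    ring_nf
    positivity
  · refine nonneg_of_mul_nonneg_right (a := y) ?_ (by linarith)
    rw [mul_eval_expDerivNum_lower]
    linarith [hsq hy]
  · rw [mul_eval_expDerivNum_lower]
    norm_num

theorem upper_bound :
    Real.exp 1 * ∫ y in Ioi (1 : ℝ), Real.exp (-y) / y ≤ 0.5964 := by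
  refine (exp_one_mul_integral_exp_neg_div_le upperNum upperDen (M := 3)
    (fun y hy => ?_) (fun y hy => ?_) (fun y hy => ?_) (fun y hy => ?_)).trans ?_
  · have hy0 : 0 < y := by linarith
    simp only [upperDen, eval_add, eval_mul, eval_pow, eval_X, eval_ofNat]
    positivity
  · have hy0 : 0 ≤ y := by linarith
    simp only [upperNum, eval_add, eval_mul, eval_pow, eval_X, eval_ofNat]
    positivity
  · obtain ⟨t, ht, rfl⟩ : ∃ t : ℝ, 0 ≤ t ∧ y = 1 + t := ⟨y - 1, by linarith, by ring⟩
    rw [← sub_nonneg]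
    simp only [upperNum, upperDen, eval_add, eval_mul, eval_pow, eval_X, eval_ofNat]
    ring_nf
    positivity
  · rw [mul_eval_expDerivNum_upper]
    have hy0 : 0 ≤ y := by linarith
    exact le_add_of_nonneg_right (by positivity)
  · norm_num [upperNum, upperDen]

end Rational

/-- the value `g(0) = e · ∫₁^∞ e^{-y}/y dy = e · E₁(1)` satisfies
`0.5963 ≤ g(0) ≤ 0.5964`; in particular `g(0) > 0.596`. -/
theorem stmt10 :
    0.5963 ≤ Real.exp 1 * (∫ y in Set.Ioi (1 : ℝ), Real.exp (-y) / y) ∧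
    Real.exp 1 * (∫ y in Set.Ioi (1 : ℝ), Real.exp (-y) / y) ≤ 0.5964 ∧
    0.596 < Real.exp 1 * (∫ y in Set.Ioi (1 : ℝ), Real.exp (-y) / y) :=
  ⟨lower_bound, upper_bound, lt_of_lt_of_le (by norm_num) lower_bound⟩
end

section
/- Let g(t) := 0.588/(0.575·t + 1) for t ≥ 0, and define f(x) := 1 − e^{−x}·(1 − g(x)·(x+1)) − ∫₀^x g(z)·e^{−z} dz for x ≥ 0. Then: (i) g is strictly decreasing on [0,∞) with values in [0,1]; (ii) g(x) − g'(x) ≤ 1 for every x ≥ 0 (indeed g(x) − g'(x) ≤ g(0) − g'(0) = 0.588 + 0.588·0.575 < 1); and (iii) f(x) ≥ f(0) = g(0) = 0.588 for every x ≥ 0, i.e. 0 is a minimizer of f. -/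
/-- The inverse scaling function `g t = 0.588/(0.575 t + 1)`. -/
noncomputable def gInv (t : ℝ) : ℝ := 0.588 / (0.575 * t + 1)

/-- `f x = 1 - e^{-x}(1 - g(x)(x+1)) - ∫₀ˣ g(z) e^{-z} dz` for `g = gInv`. -/
noncomputable def fInv (x : ℝ) : ℝ :=
  1 - Real.exp (-x) * (1 - gInv x * (x + 1)) - ∫ z in (0 : ℝ)..x, gInv z * Real.exp (-z)

theorem hasDerivAt_gInv {x : ℝ} (hx : 0 ≤ x) :
    HasDerivAt gInv (-(0.588 * 0.575) / (0.575 * x + 1) ^ 2) x := by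
  have h : HasDerivAt (fun t : ℝ => 0.575 * t + 1) 0.575 x := by
    simpa using ((hasDerivAt_id x).const_mul (0.575 : ℝ)).add_const (1 : ℝ)
  have hpos : 0 < 0.575 * x + 1 := by positivity
  refine ((hasDerivAt_const x (0.588 : ℝ)).div h hpos.ne').congr_deriv ?_
  ring

theorem hasDerivAt_exp_neg (x : ℝ) :
    HasDerivAt (fun t => Real.exp (-t)) (-Real.exp (-x)) x := by
  simpa using (hasDerivAt_neg x).exp

theorem hasDerivAt_integral_gInv {x : ℝ} (hx : 0 ≤ x) :
    HasDerivAt (fun u => ∫ z in (0 : ℝ)..u, gInv z * Real.exp (-z))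
      (gInv x * Real.exp (-x)) x := by
  have hc : ∀ t : ℝ, 0 ≤ t → ContinuousAt (fun z => gInv z * Real.exp (-z)) t := fun t ht =>
    (hasDerivAt_gInv ht).continuousAt.mul (hasDerivAt_exp_neg t).continuousAt
  have hm : Measurable (fun z => gInv z * Real.exp (-z)) := by
    unfold gInv
    fun_prop
  refine intervalIntegral.integral_hasDerivAt_right ?_
    hm.stronglyMeasurable.stronglyMeasurableAtFilter (hc x hx)
  refine ContinuousOn.intervalIntegrable fun t ht => (hc t ?_).continuousWithinAt
  rw [Set.uIcc_of_le hx] at ht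
  exact ht.1

theorem hasDerivAt_fInv {x : ℝ} (hx : 0 ≤ x) :
    HasDerivAt fInv (Real.exp (-x) *
      (1 - (x + 1) * (gInv x + 0.588 * 0.575 / (0.575 * x + 1) ^ 2))) x := by
  have h := ((hasDerivAt_exp_neg x).mul (((hasDerivAt_gInv hx).mul
    ((hasDerivAt_id x).add_const (1 : ℝ))).const_sub 1)).const_sub 1 |>.sub
      (hasDerivAt_integral_gInv hx)
  refine h.congr_deriv ?_
  simp only [id, Pi.mul_apply]
  ring

theorem fInv_zero : fInv 0 = 0.588 := by
  norm_num [fInv, gInv]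

theorem monotoneOn_fInv : MonotoneOn fInv (Set.Icc 0 0.6) := by
  refine monotoneOn_of_hasDerivWithinAt_nonneg (convex_Icc _ _)
    (fun x hx => (hasDerivAt_fInv hx.1).continuousAt.continuousWithinAt)
    (fun x hx => (hasDerivAt_fInv (interior_subset hx).1).hasDerivWithinAt) fun x hx => ?_
  obtain ⟨h0, h1⟩ := interior_subset hx
  have hpos : 0 < 0.575 * x + 1 := by positivity
  refine mul_nonneg (Real.exp_pos _).le ?_
  have : 1 - (x + 1) * (gInv x + 0.588 * 0.575 / (0.575 * x + 1) ^ 2) =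
      ((0.575 * x + 1) ^ 2 - 0.588 * (x + 1) * (0.575 * x + 1.575)) / (0.575 * x + 1) ^ 2 := by
    unfold gInv
    field_simp
    ring
  rw [this]
  refine div_nonneg ?_ (by positivity)
  norm_num at h1 ⊢
  nlinarith

/-- A convergent of the Stieltjes continued fraction of `exp y * E₁ y`, bounding it from above. -/
noncomputable def expIntegralConvergent (y : ℝ) : ℝ :=
  (y ^ 3 + 11 * y ^ 2 + 26 * y + 6) / (y ^ 4 + 12 * y ^ 3 + 36 * y ^ 2 + 24 * y)

theorem exists_hasDerivAt_expIntegralConvergent (y : ℝ) (hy : 0 < y) :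
    ∃ d, HasDerivAt expIntegralConvergent d y ∧ 1 / y ≤ expIntegralConvergent y - d := by
  have hN : HasDerivAt (fun y : ℝ => y ^ 3 + 11 * y ^ 2 + 26 * y + 6)
      (3 * y ^ 2 + 22 * y + 26) y := by
    refine (((((hasDerivAt_id y).pow 3).add (((hasDerivAt_id y).pow 2).const_mul 11)).add
      ((hasDerivAt_id y).const_mul 26)).add_const 6).congr_deriv ?_
    simp only [id]
    ring
  have hD : HasDerivAt (fun y : ℝ => y ^ 4 + 12 * y ^ 3 + 36 * y ^ 2 + 24 * y)
      (4 * y ^ 3 + 36 * y ^ 2 + 72 * y + 24) y := by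
    refine (((((hasDerivAt_id y).pow 4).add (((hasDerivAt_id y).pow 3).const_mul 12)).add
      (((hasDerivAt_id y).pow 2).const_mul 36)).add ((hasDerivAt_id y).const_mul 24)).congr_deriv ?_
    simp only [id]
    ring
  have hpos : 0 < y ^ 4 + 12 * y ^ 3 + 36 * y ^ 2 + 24 * y := by positivity
  refine ⟨_, hN.div hD hpos.ne', ?_⟩
  unfold expIntegralConvergent
  rw [← sub_nonneg]
  have : (y ^ 3 + 11 * y ^ 2 + 26 * y + 6) / (y ^ 4 + 12 * y ^ 3 + 36 * y ^ 2 + 24 * y) -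
      ((3 * y ^ 2 + 22 * y + 26) * (y ^ 4 + 12 * y ^ 3 + 36 * y ^ 2 + 24 * y) -
        (y ^ 3 + 11 * y ^ 2 + 26 * y + 6) * (4 * y ^ 3 + 36 * y ^ 2 + 72 * y + 24)) /
        (y ^ 4 + 12 * y ^ 3 + 36 * y ^ 2 + 24 * y) ^ 2 - 1 / y =
      144 / (y ^ 4 + 12 * y ^ 3 + 36 * y ^ 2 + 24 * y) ^ 2 := by
    field_simp
    ring
  rw [this]
  positivity

theorem integral_gInv_le {x : ℝ} (hx : 0 ≤ x) :
    ∫ z in (0 : ℝ)..x, gInv z * Real.exp (-z) ≤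
      588 / 575 * (expIntegralConvergent (40 / 23) -
        Real.exp (-x) * expIntegralConvergent (x + 40 / 23)) := by
  choose! d hd hle using exists_hasDerivAt_expIntegralConvergent
  have hderiv : ∀ t : ℝ, 0 ≤ t → HasDerivAt
      (fun x => 588 / 575 * (expIntegralConvergent (40 / 23) -
        Real.exp (-x) * expIntegralConvergent (x + 40 / 23)) -
          ∫ z in (0 : ℝ)..x, gInv z * Real.exp (-z))
      (588 / 575 * Real.exp (-t) * (expIntegralConvergent (t + 40 / 23) - d (t + 40 / 23) -
        1 / (t + 40 / 23))) t := by
    intro t ht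
    have hg : gInv t = 588 / 575 * (1 / (t + 40 / 23)) := by
      have h1 : 0 < 0.575 * t + 1 := by positivity
      have h2 : 0 < t + 40 / 23 := by positivity
      unfold gInv
      field_simp
      ring
    have hR := (hd (t + 40 / 23) (by positivity)).comp_add_const t (40 / 23)
    refine (((((hasDerivAt_exp_neg t).mul hR).const_sub _).const_mul (588 / 575)).sub
      (hasDerivAt_integral_gInv ht)).congr_deriv ?_
    rw [hg]
    ring
  have hmono := monotoneOn_of_hasDerivWithinAt_nonneg (convex_Ici (0 : ℝ))
    (fun t ht => (hderiv t ht).continuousAt.continuousWithinAt)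
    (fun t ht => (hderiv t (interior_subset ht)).hasDerivWithinAt) fun t ht =>
      mul_nonneg (by positivity) (sub_nonneg.2 (hle _
        (add_pos_of_nonneg_of_pos (interior_subset ht) (by norm_num))))
  have h := hmono Set.self_mem_Ici hx hx
  simp only [neg_zero, Real.exp_zero, zero_add, one_mul, sub_self, mul_zero,
    intervalIntegral.integral_same] at h
  linarith

theorem le_fInv_of_ge {x : ℝ} (hx : 0.6 ≤ x) : 0.588 ≤ fInv x := by
  have hx0 : 0 ≤ x := le_trans (by norm_num) hx
  have hint := integral_gInv_le hx0
  have hc : 588 / 575 * expIntegralConvergent (40 / 23) ≤ 0.412 := by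
    norm_num [expIntegralConvergent]
  have hB : 0 ≤ 588 / 575 * expIntegralConvergent (x + 40 / 23) - 1 + gInv x * (x + 1) := by
    obtain ⟨z, hz, rfl⟩ : ∃ z, 0 ≤ z ∧ x = z + 0.6 := ⟨x - 0.6, by linarith, by ring⟩
    unfold expIntegralConvergent gInv
    have h1 : 0 < 0.575 * (z + 0.6) + 1 := by positivity
    rw [mul_div_assoc', div_mul_eq_mul_div, div_sub_one (by positivity),
      div_mul_eq_mul_div (0.588 : ℝ), div_add_div _ _ (by positivity) h1.ne']
    refine div_nonneg ?_ (by positivity)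
    ring_nf
    positivity
  have := mul_nonneg (Real.exp_pos (-x)).le hB
  unfold fInv
  norm_num at hc ⊢
  nlinarith

/-- `gInv` is strictly decreasing on `[0,∞)` with values in `[0,1]`,
satisfies `g(x) - g'(x) ≤ 1` on `[0,∞)`, and `0` is a minimizer of `fInv` with
`fInv 0 = gInv 0 = 0.588`. -/
theorem stmt11 :
    StrictAntiOn gInv (Set.Ici 0) ∧
    (∀ x : ℝ, 0 ≤ x → gInv x ∈ Set.Icc (0 : ℝ) 1) ∧
    (∀ x : ℝ, 0 ≤ x → gInv x - deriv gInv x ≤ 1) ∧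
    (∀ x : ℝ, 0 ≤ x → fInv 0 ≤ fInv x) ∧
    fInv 0 = gInv 0 ∧ gInv 0 = 0.588 ∧
    gInv 0 - deriv gInv 0 = 0.588 + 0.588 * 0.575 ∧ 0.588 + 0.588 * 0.575 < 1 := by
  refine ⟨fun x hx y _ hxy => ?_, fun x hx => ?_, fun x hx => ?_, fun x hx => ?_,
    ?_, ?_, ?_, by decide⟩
  · have hx0 : (0 : ℝ) ≤ x := hx
    unfold gInv
    gcongr
  · have hpos : 0 < 0.575 * x + 1 := by positivity
    unfold gInv
    exact ⟨by positivity, by rw [div_le_one hpos]; norm_num; linarith⟩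
  · have hpos : 0 < 0.575 * x + 1 := by positivity
    have h1 : 0.588 / (0.575 * x + 1) ≤ 0.588 := div_le_self (by norm_num) (by linarith)
    have h2 : 0.588 * 0.575 / (0.575 * x + 1) ^ 2 ≤ 0.588 * 0.575 :=
      div_le_self (by norm_num) (one_le_pow₀ (by linarith))
    rw [(hasDerivAt_gInv hx).deriv, gInv, neg_div]
    norm_num at h1 h2 ⊢
    linarith
  · rw [fInv_zero]
    rcases le_total x 0.6 with h | h
    · have := monotoneOn_fInv ⟨le_rfl, by norm_num⟩ ⟨hx, h⟩ hx
      rwa [fInv_zero] at this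
    · exact le_fInv_of_ge h
  · rw [fInv_zero]; norm_num [gInv]
  · norm_num [gInv]
  · rw [(hasDerivAt_gInv le_rfl).deriv]; norm_num [gInv]
end

section
/- Let g(t) := 0.581·e^{−0.535·t} for t ≥ 0, and define f(x) := 1 − e^{−x}·(1 − g(x)·(x+1)) − ∫₀^x g(z)·e^{−z} dz for x ≥ 0. Then: (i) g is strictly decreasing on [0,∞) with values in [0,1]; (ii) g(x) − g'(x) = 0.581·(1 + 0.535)·e^{−0.535·x} ≤ 1 for every x ≥ 0; and (iii) f(x) ≥ f(0) = g(0) = 0.581 for every x ≥ 0, i.e. 0 is a minimizer of f. -/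
/-- The exponential scaling function `g t = 0.581 · e^{-0.535 t}`. -/
noncomputable def gExp (t : ℝ) : ℝ := 0.581 * Real.exp (-(0.535 * t))

/-- `f x = 1 - e^{-x}(1 - g(x)(x+1)) - ∫₀ˣ g(z) e^{-z} dz` for `g = gExp`. -/
noncomputable def fExp (x : ℝ) : ℝ :=
  1 - Real.exp (-x) * (1 - gExp x * (x + 1)) - ∫ z in (0 : ℝ)..x, gExp z * Real.exp (-z)

theorem hasDerivAt_gExp (x : ℝ) : HasDerivAt gExp (-0.535 * gExp x) x := by
  have h : HasDerivAt (fun t : ℝ => -(0.535 * t)) (-0.535) x := by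
    exact ((hasDerivAt_id x).const_mul (0.535 : ℝ)).neg.congr_deriv (by ring)
  exact (h.exp.const_mul (0.581 : ℝ)).congr_deriv (by unfold gExp; ring)

/-- A primitive of `gExp z * exp (-z)` is `-(gExp z * exp (-z)) / 1.535`. -/
theorem fExp_eq (x : ℝ) :
    fExp x = 1 - Real.exp (-x) * (1 - gExp x * (x + 1))
      + (gExp x * Real.exp (-x) - 0.581) / 1.535 := by
  have hd : ∀ z : ℝ, HasDerivAt (fun z => -(gExp z * Real.exp (-z)) / 1.535)
      (gExp z * Real.exp (-z)) z := fun z =>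
    (((hasDerivAt_gExp z).mul (hasDerivAt_neg z).exp).neg.div_const 1.535).congr_deriv
      (by ring)
  have hg : Continuous gExp := by unfold gExp; fun_prop
  have hc : Continuous fun z : ℝ => gExp z * Real.exp (-z) := by fun_prop
  rw [fExp, intervalIntegral.integral_eq_sub_of_hasDerivAt (fun z _ => hd z)
    (hc.intervalIntegrable 0 x)]
  have h0 : gExp 0 = 0.581 := by simp [gExp]
  simp only [h0, neg_zero, Real.exp_zero]
  ring

/-- The factor of `deriv fExp` that carries its sign. -/
noncomputable def fExpSlope (x : ℝ) : ℝ := Real.exp (0.535 * x) - 0.891835 * (x + 1)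

theorem hasDerivAt_fExp (x : ℝ) :
    HasDerivAt fExp (Real.exp (-x) * Real.exp (-(0.535 * x)) * fExpSlope x) x := by
  have he := (hasDerivAt_neg x).exp
  have hg := hasDerivAt_gExp x
  have h := ((he.mul ((hg.mul ((hasDerivAt_id x).add_const 1)).const_sub 1)).const_sub 1).add
    (((hg.mul he).sub_const 0.581).div_const 1.535)
  rw [funext fExp_eq]
  refine h.congr_deriv ?_
  have hm : Real.exp (-(0.535 * x)) * Real.exp (0.535 * x) = 1 := by
    rw [← Real.exp_add]; simp
  simp only [fExpSlope, gExp, id, Pi.mul_apply]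
  linear_combination (-Real.exp (-x)) * hm

theorem strictConvexOn_fExpSlope : StrictConvexOn ℝ Set.univ fExpSlope := by
  refine ⟨convex_univ, fun x _ y _ hxy a b ha hb hab => ?_⟩
  have h := strictConvexOn_exp.2 (Set.mem_univ (0.535 * x)) (Set.mem_univ (0.535 * y))
    (mul_right_injective₀ (by norm_num) |>.ne hxy) ha hb hab
  simp only [smul_eq_mul, fExpSlope] at h ⊢
  rw [show 0.535 * (a * x + b * y) = a * (0.535 * x) + b * (0.535 * y) by ring]
  linear_combination h + 0.891835 * hab

theorem fExpSlope_lt_max {x y z : ℝ} (hxy : x < y) (hyz : y < z) :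
    fExpSlope y < max (fExpSlope x) (fExpSlope z) :=
  strictConvexOn_fExpSlope.lt_on_openSegment (Set.mem_univ x) (Set.mem_univ z)
    (hxy.trans hyz).ne (by rw [openSegment_eq_Ioo (hxy.trans hyz)]; exact ⟨hxy, hyz⟩)

theorem monotoneOn_fExp {a b : ℝ} (h : ∀ x ∈ Set.Ioo a b, 0 ≤ fExpSlope x) :
    MonotoneOn fExp (Set.Icc a b) := by
  refine monotoneOn_of_deriv_nonneg (convex_Icc a b)
    (fun x _ => (hasDerivAt_fExp x).continuousAt.continuousWithinAt)
    (fun x _ => (hasDerivAt_fExp x).differentiableAt.differentiableWithinAt) fun x hx => ?_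
  rw [(hasDerivAt_fExp x).deriv]
  exact mul_nonneg (by positivity) (h x (interior_Icc (a := a) (b := b) ▸ hx))

theorem antitoneOn_fExp {a b : ℝ} (h : ∀ x ∈ Set.Ioo a b, fExpSlope x ≤ 0) :
    AntitoneOn fExp (Set.Icc a b) := by
  refine antitoneOn_of_deriv_nonpos (convex_Icc a b)
    (fun x _ => (hasDerivAt_fExp x).continuousAt.continuousWithinAt)
    (fun x _ => (hasDerivAt_fExp x).differentiableAt.differentiableWithinAt) fun x hx => ?_
  rw [(hasDerivAt_fExp x).deriv]
  exact mul_nonpos_of_nonneg_of_nonpos (by positivity)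
    (h x (interior_Icc (a := a) (b := b) ▸ hx))

theorem fExpSlope_neg : fExpSlope 1.49 < 0 := by
  have h := Real.exp_bound' (x := 0.535 * 1.49) (by norm_num) (by norm_num) (n := 7) (by norm_num)
  norm_num [Finset.sum_range_succ, Nat.factorial] at h
  norm_num [fExpSlope]
  linarith

theorem fExpSlope_pos : 0 < fExpSlope 1.5 := by
  have h := Real.sum_le_exp_of_nonneg (x := 0.535 * 1.5) (by norm_num) 7
  norm_num [Finset.sum_range_succ, Nat.factorial] at h
  norm_num [fExpSlope]
  linarith

/-- The second critical point of `fExp`, where it has its other local minimum. -/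
theorem exists_fExpSlope_eq_zero : ∃ b ∈ Set.Ioo (1.49 : ℝ) 1.5, fExpSlope b = 0 := by
  have hc : Continuous fExpSlope := by unfold fExpSlope; fun_prop
  exact intermediate_value_Ioo (by norm_num) hc.continuousOn ⟨fExpSlope_neg, fExpSlope_pos⟩

theorem fExp_zero : fExp 0 = 0.581 := by
  rw [fExp_eq]; norm_num [gExp]

theorem fExp_ge_of_fExpSlope_eq_zero {b : ℝ} (hb : b ∈ Set.Ioo (1.49 : ℝ) 1.5)
    (h : fExpSlope b = 0) : 0.581 ≤ fExp b := by
  obtain ⟨h1, h2⟩ := hb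
  have hE : gExp b * (0.891835 * (b + 1)) = 0.581 := by
    have hm : Real.exp (-(0.535 * b)) * Real.exp (0.535 * b) = 1 := by
      rw [← Real.exp_add]; simp
    rw [fExpSlope] at h
    rw [gExp]
    linear_combination 0.581 * hm - 0.581 * Real.exp (-(0.535 * b)) * h
  have hexp : Real.exp (-b) ≤ 0.2256 := by
    have h3 := Real.sum_le_exp_of_nonneg (x := 1.49) (by norm_num) 9
    have h4 : Real.exp 1.49 ≤ Real.exp b := Real.exp_le_exp.2 h1.le
    have h5 : (4.436 : ℝ) ≤ Real.exp 1.49 :=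
      le_trans (by norm_num [Finset.sum_range_succ, Nat.factorial]) h3
    rw [Real.exp_neg]
    exact inv_le_of_inv_le₀ (by norm_num) (by norm_num; linarith)
  have hg : 0.26058 ≤ gExp b := by
    by_contra! hlt
    nlinarith
  have hgx : gExp b * (b + 1) = 0.581 / 0.891835 := by linarith
  rw [fExp_eq, hgx]
  have hpos := Real.exp_pos (-b)
  have hmul := mul_le_mul_of_nonneg_left hg hpos.le
  norm_num at hmul hexp ⊢
  linarith

theorem fExp_zero_le {x : ℝ} (hx : 0 ≤ x) : fExp 0 ≤ fExp x := by
  obtain ⟨b, hb, hb0⟩ := exists_fExpSlope_eq_zero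
  have hfb : fExp 0 ≤ fExp b := fExp_zero ▸ fExp_ge_of_fExpSlope_eq_zero hb hb0
  rcases le_total b x with hbx | hxb
  · refine hfb.trans (monotoneOn_fExp (fun y hy => ?_) ⟨le_rfl, hbx⟩ ⟨hbx, le_rfl⟩ hbx)
    by_contra! hneg
    have := fExpSlope_lt_max hb.1 hy.1
    exact absurd (this.trans (max_lt fExpSlope_neg hneg)) (by simp [hb0])
  · by_cases hs : fExpSlope x ≤ 0
    · refine hfb.trans (antitoneOn_fExp (fun y hy => ?_) ⟨le_rfl, hxb⟩ ⟨hxb, le_rfl⟩ hxb)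
      exact (fExpSlope_lt_max hy.1 hy.2).le.trans (max_le hs hb0.le)
    · refine monotoneOn_fExp (fun y hy => ?_) ⟨le_rfl, hx⟩ ⟨hx, le_rfl⟩ hx
      by_contra! hneg
      have hxb' : x < b := hxb.lt_of_ne fun h => hs (h ▸ hb0.le)
      exact hs ((fExpSlope_lt_max hy.2 hxb').le.trans (max_le hneg.le hb0.le))

/-- `gExp` is strictly decreasing on `[0,∞)` with values in `[0,1]`,
`g(x) - g'(x) = 0.581 (1 + 0.535) e^{-0.535 x} ≤ 1` on `[0,∞)`, and `0` is a
minimizer of `fExp` with `fExp 0 = gExp 0 = 0.581`. -/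
theorem stmt12 :
    StrictAntiOn gExp (Set.Ici 0) ∧
    (∀ x : ℝ, 0 ≤ x → gExp x ∈ Set.Icc (0 : ℝ) 1) ∧
    (∀ x : ℝ, 0 ≤ x →
      gExp x - deriv gExp x = 0.581 * (1 + 0.535) * Real.exp (-(0.535 * x)) ∧
      gExp x - deriv gExp x ≤ 1) ∧
    (∀ x : ℝ, 0 ≤ x → fExp 0 ≤ fExp x) ∧
    fExp 0 = gExp 0 ∧ gExp 0 = 0.581 := by
  refine ⟨fun x _ y _ hxy => ?_, fun x hx => ?_, fun x hx => ?_, fun x hx => fExp_zero_le hx,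
    ?_, ?_⟩
  · unfold gExp
    gcongr
  · have h : Real.exp (-(0.535 * x)) ≤ 1 := Real.exp_le_one_iff.2 (by linarith)
    unfold gExp
    exact ⟨by positivity, by linarith⟩
  · have h : Real.exp (-(0.535 * x)) ≤ 1 := Real.exp_le_one_iff.2 (by linarith)
    have hd : gExp x - deriv gExp x = 0.581 * (1 + 0.535) * Real.exp (-(0.535 * x)) := by
      rw [(hasDerivAt_gExp x).deriv, gExp]
      ring
    exact ⟨hd, by rw [hd]; linarith⟩
  · rw [fExp_zero]; simp [gExp]
  · simp [gExp]
end
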